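/- Let Q be a logic, let B be a maximal Boolean sublogic of Q, and let A be a subset of Q with B ⊆ A ⊆ Q. Then com(A) ∈ B, and every element of A lying below com(A) belongs to B, i.e., [0, com(A)] ∩ A ⊆ B. -/

import Mathlib

/-- A *logic*: a complete orthomodular lattice. -/
class COL (Q : Type*) extends CompleteLattice Q where
  /-- orthocomplementation -/
  oc : Q → Q
  oc_antitone : ∀ {P R : Q}, P ≤ R → oc R ≤ oc P
  oc_oc : ∀ P : Q, oc (oc P) = P
  sup_oc : ∀ P : Q, P ⊔ oc P = ⊤
  inf_oc : ∀ P : Q, P ⊓ oc P = ⊥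
  orthomodular : ∀ {P R : Q}, P ≤ R → P ⊔ (oc P ⊓ R) = R

variable {Q : Type*} [COL Q]

/-- `P` commutes with `R`, written `P ∘ R` in the paper. -/
def COL.commutes (P R : Q) : Prop := P = (P ⊓ R) ⊔ (P ⊓ COL.oc R)

/-- The commutant `A^!` of a subset `A` of a logic. -/
def COL.commutant (A : Set Q) : Set Q := {P : Q | ∀ R ∈ A, COL.commutes P R}

/-- The sublogic `L(A) = A^!!` generated by `A`. -/
def COL.Lgen (A : Set Q) : Set Q := COL.commutant (COL.commutant A)

/-- The center `Z(A) = A^! ∩ A^!!` of the sublogic generated by `A`. -/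
def COL.Zcen (A : Set Q) : Set Q := COL.commutant A ∩ COL.Lgen A

/-- The set `S(A)` of subcommutators of `A`. -/
def COL.subcom (A : Set Q) : Set Q :=
  {E : Q | E ∈ COL.Zcen A ∧ ∀ P1 ∈ A, ∀ P2 ∈ A, COL.commutes (P1 ⊓ E) (P2 ⊓ E)}

/-- Takeuti's commutator `com(A)`. -/
def COL.com (A : Set Q) : Q :=
  sSup {E : Q | E ∈ COL.commutant A ∧ ∀ P1 ∈ A, ∀ P2 ∈ A, COL.commutes (P1 ⊓ E) (P2 ⊓ E)}

namespace COL

theorem commutes_of_le {P R : Q} (h : P ≤ (P ⊓ R) ⊔ (P ⊓ oc R)) : commutes P R :=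
  le_antisymm h (sup_le inf_le_left inf_le_left)

theorem commutes_refl (P : Q) : commutes P P :=
  commutes_of_le (le_sup_of_le_left (le_inf le_rfl le_rfl))

theorem le_oc_comm {P R : Q} (h : P ≤ oc R) : R ≤ oc P := by
  simpa only [oc_oc] using oc_antitone h

theorem oc_le_comm {P R : Q} (h : oc P ≤ R) : oc R ≤ P := by
  simpa only [oc_oc] using oc_antitone h

/-- The dual form of the orthomodular law. -/
theorem inf_sup_oc_le {M X : Q} (h : M ≤ X) : X ⊓ (M ⊔ oc X) ≤ M := by
  have h1 : oc X ⊔ (X ⊓ oc M) = oc M := by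
    simpa only [oc_oc] using orthomodular (oc_antitone h)
  refine (le_oc_comm ?_).trans_eq (oc_oc M)
  rw [← h1]
  refine sup_le (oc_antitone inf_le_left) (le_oc_comm ?_)
  exact inf_le_right.trans (sup_le (le_oc_comm inf_le_right) (oc_antitone inf_le_left))

theorem commutes.symm {P R : Q} (h : commutes P R) : commutes R P := by
  have hP : P ≤ (P ⊓ R) ⊔ oc R := h.le.trans (sup_le_sup_left inf_le_right _)
  have hR : oc (P ⊓ R) ⊓ R ≤ oc P := by
    refine le_oc_comm (hP.trans (sup_le ?_ ?_))
    · exact le_oc_comm inf_le_left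
    · exact oc_antitone inf_le_right
  apply commutes_of_le
  calc R = (P ⊓ R) ⊔ (oc (P ⊓ R) ⊓ R) := (orthomodular inf_le_right).symm
    _ ≤ (R ⊓ P) ⊔ (R ⊓ oc P) := sup_le_sup (inf_comm _ _).le (le_inf inf_le_right hR)

theorem commutes_sSup {S : Set Q} {R : Q} (h : ∀ P ∈ S, commutes P R) :
    commutes (sSup S) R := by
  refine commutes_of_le (sSup_le fun P hP => (h P hP).le.trans ?_)
  exact sup_le_sup (inf_le_inf_right _ (le_sSup hP)) (inf_le_inf_right _ (le_sSup hP))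

theorem inf_sSup_of_commutes {S : Set Q} {X : Q} (h : ∀ E ∈ S, commutes E X) :
    X ⊓ sSup S = sSup ((fun E => X ⊓ E) '' S) := by
  apply le_antisymm
  · have hM : sSup ((fun E => X ⊓ E) '' S) ≤ X := by
      exact sSup_le (by rintro _ ⟨E, -, rfl⟩; exact inf_le_left)
    refine le_trans (inf_le_inf_left X (sSup_le fun E hE => (h E hE).le.trans ?_))
      (inf_sup_oc_le hM)
    exact sup_le_sup ((inf_comm _ _).le.trans (le_sSup ⟨E, hE, rfl⟩)) inf_le_right
  · apply sSup_le
    rintro _ ⟨E, hE, rfl⟩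
    exact inf_le_inf_left X (le_sSup hE)

theorem inf_oc_inf_le {E R : Q} (h : commutes E R) : E ⊓ oc (R ⊓ E) ≤ E ⊓ oc R := by
  have hle : E ⊓ oc R ≤ oc (R ⊓ E) := inf_le_right.trans (oc_antitone inf_le_left)
  refine le_trans (le_inf inf_le_right (inf_le_left.trans (h.le.trans ?_))) (inf_sup_oc_le hle)
  rw [oc_oc, sup_comm, inf_comm R E]

theorem commutes_inf_left {X R E : Q} (hE : commutes E R) (h : commutes (X ⊓ E) (R ⊓ E)) :
    commutes (X ⊓ E) R := by
  refine commutes_of_le (h.le.trans (sup_le_sup (inf_le_inf_left _ inf_le_left) ?_))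
  refine le_inf inf_le_left (le_trans ?_ ((inf_oc_inf_le hE).trans inf_le_right))
  exact inf_le_inf_right _ inf_le_right

theorem commutant_antitone {A B : Set Q} (h : A ⊆ B) : commutant B ⊆ commutant A :=
  fun _ hP R hR => hP R (h hR)

theorem subset_commutant_commutant (A : Set Q) : A ⊆ commutant (commutant A) :=
  fun P hP _ hR => (hR P hP).symm

theorem commutant_commutant_commutant (A : Set Q) :
    commutant (commutant (commutant A)) = commutant A :=
  (commutant_antitone (subset_commutant_commutant A)).antisymm (subset_commutant_commutant _)

/-- A maximal Boolean sublogic contains its commutant. -/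
theorem commutant_subset_of_maximal {B : Set Q} (hBBool : B ⊆ commutant B)
    (hBmax : ∀ B' : Set Q, B' = commutant (commutant B') →
      B' ⊆ commutant B' → B ⊆ B' → B' = B) :
    commutant B ⊆ B := by
  intro P hP
  have hC : insert P B ⊆ commutant (insert P B) := by
    rintro X (rfl | hX) Y (rfl | hY)
    · exact commutes_refl _
    · exact hP Y hY
    · exact (hP X hX).symm
    · exact hBBool hX Y hY
  have hsub := subset_commutant_commutant (insert P B)
  rw [← hBmax (commutant (commutant (insert P B)))
    (commutant_commutant_commutant (commutant (insert P B))).symm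
    ((commutant_antitone hC).trans (commutant_commutant_commutant _).ge)
    ((Set.subset_insert P B).trans hsub)]
  exact hsub (Set.mem_insert P B)

end COL

/-- Theorem 2.6: if `B` is a maximal Boolean sublogic of `Q` and `B ⊆ A ⊆ Q`, then
`com(A) ∈ B` and `[0, com(A)] ∩ A ⊆ B`. -/
theorem stmt5 (B A : Set Q)
    (hBsub : B = COL.commutant (COL.commutant B))
    (hBBool : B ⊆ COL.commutant B)
    (hBmax : ∀ B' : Set Q, B' = COL.commutant (COL.commutant B') →
      B' ⊆ COL.commutant B' → B ⊆ B' → B' = B)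
    (hBA : B ⊆ A) :
    COL.com A ∈ B ∧ Set.Icc ⊥ (COL.com A) ∩ A ⊆ B := by
  have hB := COL.commutant_subset_of_maximal hBBool hBmax
  refine ⟨hB fun R hR => COL.commutes_sSup fun E hE => hE.1 R (hBA hR), ?_⟩
  rintro X ⟨⟨-, hX⟩, hXA⟩
  refine hB fun R hR => ?_
  rw [← inf_eq_left.mpr hX, COL.com, COL.inf_sSup_of_commutes fun E hE => hE.1 X hXA]
  apply COL.commutes_sSup
  rintro _ ⟨E, hE, rfl⟩
  exact COL.commutes_inf_left (hE.1 R (hBA hR)) (hE.2 X hXA R (hBA hR))
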